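/- arXiv:2310.12016 — 2 statements merged into one kernel-verified Lean document; each statement's English description precedes it below -/
import Mathlib

section
/- The quasi-solution never vanishes: for every integer n ≥ 1 and every λ ∈ ℂ with Re λ ≥ 0, the quantity r̃_n(λ) := λ²/(8n²+33n+28) + 5λ/(5n+16) + (5n+6)/(5n+13) is nonzero. -/
/-- The quasi-solution `r̃_n(λ)` of the mode stability analysis. -/
noncomputable def quasiSol (n : ℕ) (l : ℂ) : ℂ :=
  l ^ 2 / (8 * (n : ℂ) ^ 2 + 33 * n + 28) + 5 * l / (5 * (n : ℂ) + 16)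
    + (5 * (n : ℂ) + 6) / (5 * (n : ℂ) + 13)

/-- A quadratic with positive linear and constant coefficients and nonnegative leading coefficient
has no zeros in the closed right half-plane. -/
theorem quadratic_ne_zero_of_re_nonneg {a b c : ℝ} (ha : 0 ≤ a) (hb : 0 < b) (hc : 0 < c)
    {z : ℂ} (hz : 0 ≤ z.re) : (a : ℂ) * z ^ 2 + b * z + c ≠ 0 := by
  intro h
  have hre := congrArg Complex.re h
  have him := congrArg Complex.im h
  simp only [pow_two, Complex.add_re, Complex.add_im, Complex.mul_re, Complex.mul_im,
    Complex.ofReal_re, Complex.ofReal_im, Complex.zero_re, Complex.zero_im] at hre him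
  have hy : z.im * (2 * a * z.re + b) = 0 := by linear_combination him
  have hpos : 0 < 2 * a * z.re + b := by positivity
  have hy0 : z.im = 0 := (mul_eq_zero.mp hy).resolve_right hpos.ne'
  rw [hy0] at hre
  have : 0 < a * z.re ^ 2 + b * z.re + c := by positivity
  linarith

/-- The quasi-solution never vanishes on the closed right half-plane. -/
theorem quasiSol_ne_zero (n : ℕ) (hn : 1 ≤ n) (l : ℂ) (hl : 0 ≤ l.re) :
    quasiSol n l ≠ 0 := by
  have h := quadratic_ne_zero_of_re_nonneg (a := 1 / (8 * (n : ℝ) ^ 2 + 33 * n + 28))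
    (b := 5 / (5 * (n : ℝ) + 16)) (c := (5 * (n : ℝ) + 6) / (5 * (n : ℝ) + 13))
    (by positivity) (by positivity) (by positivity) hl
  convert h using 1
  unfold quasiSol
  push_cast
  ring
end

section
/- For every λ ∈ ℂ with Re λ ≥ 0, the sequence (a_n(λ)) defined by a₀(λ) = 1, a₁(λ) = (λ²+12λ+12)/28, and a_{n+2}(λ) = A_n(λ)a_{n+1}(λ) + B_n(λ)a_n(λ) satisfies a_n(λ) ≠ 0 for all n ≥ 1, and a_{n+1}(λ)/a_n(λ) → 1 as n → ∞. In particular, the power series Σ_{n=0}^∞ a_n(λ) z^n has radius of convergence exactly 1. -/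
open Filter

/-- The coefficient `A_n(λ)` of the recurrence relation. -/
noncomputable def An (n : ℕ) (l : ℂ) : ℂ :=
  (12 * (n : ℂ) ^ 2 + (8 * l + 56) * n + l ^ 2 + 20 * l + 56) /
    (8 * (n : ℂ) ^ 2 + 52 * n + 72)

/-- The coefficient `B_n(λ)` of the recurrence relation. -/
noncomputable def Bn (n : ℕ) (l : ℂ) : ℂ :=
  -(4 * (n : ℂ) ^ 2 + (4 * l + 12) * n + l ^ 2 + 6 * l + 8) /
    (8 * (n : ℂ) ^ 2 + 52 * n + 72)

/-- The rescaled ratio `4 (n + 1) (2 n + 7) a_{n+1} / ((λ + 2 n + 2) a_n)`. It satisfies a continued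
fraction recurrence whose partial numerators are positive reals. -/
noncomputable def scaledRatio (l : ℂ) (a : ℕ → ℂ) (n : ℕ) : ℂ :=
  (8 * (n : ℂ) ^ 2 + 36 * n + 28) * a (n + 1) / ((l + 2 * n + 2) * a n)

lemma re_div_le_of_le_re {c g : ℝ} {v : ℂ} (hc : 0 ≤ c) (hg : 0 < g) (hv : g ≤ v.re) :
    ((c : ℂ) / v).re ≤ c / g := by
  refine (Complex.re_le_norm _).trans ?_
  rw [norm_div, Complex.norm_of_nonneg hc]
  have := hv.trans (Complex.re_le_norm v)
  gcongr

lemma add_two_mul_nat_add_ne_zero {l : ℂ} (hl : 0 ≤ l.re) (n : ℕ) {c : ℝ} (hc : 0 < c) :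
    l + 2 * n + c ≠ 0 := by
  intro h
  have h2 := congrArg Complex.re h
  simp at h2
  have : (0 : ℝ) ≤ n := n.cast_nonneg
  linarith

lemma quadratic_nat_ne_zero {b c : ℝ} (hb : 0 ≤ b) (hc : 0 < c) (n : ℕ) :
    8 * (n : ℂ) ^ 2 + b * n + c ≠ 0 := by
  have h : (0 : ℝ) < 8 * (n : ℝ) ^ 2 + b * n + c := by positivity
  exact_mod_cast h.ne'

lemma scaledRatio_succ {l : ℂ} (hl : 0 ≤ l.re) {a : ℕ → ℂ}
    (hrec : ∀ k : ℕ, a (k + 2) = An k l * a (k + 1) + Bn k l * a k) {n : ℕ}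
    (hn1 : a (n + 1) ≠ 0) :
    scaledRatio l a (n + 1) = l + 6 * n + 16 - ((8 : ℝ) : ℂ) / (l + 2 * n + 4) -
      ((8 * (n : ℝ) ^ 2 + 36 * n + 28 : ℝ) : ℂ) / scaledRatio l a n := by
  have e4 := add_two_mul_nat_add_ne_zero hl n (c := 4) (by norm_num)
  have q1 := quadratic_nat_ne_zero (b := 36) (c := 28) (by norm_num) (by norm_num) n
  have q2 := quadratic_nat_ne_zero (b := 52) (c := 72) (by norm_num) (by norm_num) n
  push_cast at e4 q1 q2
  have hD : 8 * ((n + 1 : ℕ) : ℂ) ^ 2 + 36 * ((n + 1 : ℕ) : ℂ) + 28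
      = 8 * (n : ℂ) ^ 2 + 52 * n + 72 := by push_cast; ring
  have hL : l + 2 * ((n + 1 : ℕ) : ℂ) + 2 = l + 2 * n + 4 := by push_cast; ring
  have hF : ((8 * (n : ℝ) ^ 2 + 36 * n + 28 : ℝ) : ℂ) / scaledRatio l a n
      = (l + 2 * n + 2) * a n / a (n + 1) := by
    unfold scaledRatio
    push_cast
    rw [div_div_eq_mul_div, mul_div_mul_left _ _ q1]
  have hA : (8 * (n : ℂ) ^ 2 + 52 * n + 72) * a (n + 2)
      = ((l + 2 * n + 4) * (l + 6 * n + 16) - 8) * a (n + 1)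
        - (l + 2 * n + 2) * (l + 2 * n + 4) * a n := by
    rw [hrec n, An, Bn]
    generalize 8 * (n : ℂ) ^ 2 + 52 * n + 72 = D at q2
    field_simp
    ring
  rw [hF, scaledRatio, hD, hL, hA]
  push_cast
  field_simp

lemma ne_zero_and_le_re_scaledRatio {l : ℂ} (hl : 0 ≤ l.re) {a : ℕ → ℂ}
    (h0 : a 0 = 1) (h1 : a 1 = (l ^ 2 + 12 * l + 12) / 28)
    (hrec : ∀ k : ℕ, a (k + 2) = An k l * a (k + 1) + Bn k l * a k) (n : ℕ) :
    a n ≠ 0 ∧ 3 * (n : ℝ) + 5 ≤ (scaledRatio l a n).re := by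
  induction n with
  | zero =>
    refine ⟨by simp [h0], ?_⟩
    have e2 := add_two_mul_nat_add_ne_zero hl 0 (c := 2) (by norm_num)
    have hv : scaledRatio l a 0 = l + 10 - ((8 : ℝ) : ℂ) / (l + 2) := by
      simp only [scaledRatio, h0, h1, zero_add]
      simp at e2 ⊢
      field_simp
      ring
    have hb : (((8 : ℝ) : ℂ) / (l + 2)).re ≤ 8 / 2 :=
      re_div_le_of_le_re (by norm_num) (by norm_num) (by simpa using hl)
    rw [hv, Complex.sub_re, Complex.add_re]
    norm_num at hb ⊢
    linarith
  | succ n ih =>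
    obtain ⟨hn, hv⟩ := ih
    have hn0 : (0 : ℝ) ≤ n := n.cast_nonneg
    have hn1 : a (n + 1) ≠ 0 := by
      intro h
      simp [scaledRatio, h] at hv
      linarith
    refine ⟨hn1, ?_⟩
    rw [scaledRatio_succ hl hrec hn1]
    have hb : (((8 : ℝ) : ℂ) / (l + 2 * n + 4)).re ≤ 8 / (2 * n + 4) :=
      re_div_le_of_le_re (by norm_num) (by positivity) (by simpa using hl)
    have hc : (((8 * (n : ℝ) ^ 2 + 36 * n + 28 : ℝ) : ℂ) / scaledRatio l a n).re
        ≤ (8 * (n : ℝ) ^ 2 + 36 * n + 28) / (3 * n + 5) :=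
      re_div_le_of_le_re (by positivity) (by positivity) hv
    have key : (8 : ℝ) / (2 * n + 4) + (8 * (n : ℝ) ^ 2 + 36 * n + 28) / (3 * n + 5)
        ≤ 3 * n + 8 := by
      rw [div_add_div _ _ (by positivity) (by positivity), div_le_iff₀ (by positivity)]
      nlinarith [pow_nonneg hn0 2, pow_nonneg hn0 3]
    simp only [Complex.sub_re, Complex.add_re] at *
    have h6 : (6 * (n : ℂ)).re = 6 * n := by simp
    have h16 : (16 : ℂ).re = 16 := by simp
    rw [h6, h16]
    push_cast at *
    linarith

lemma exists_norm_scaledRatio_sub_le {l : ℂ} (hl : 0 ≤ l.re) {a : ℕ → ℂ}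
    (h0 : a 0 = 1) (h1 : a 1 = (l ^ 2 + 12 * l + 12) / 28)
    (hrec : ∀ k : ℕ, a (k + 2) = An k l * a (k + 1) + Bn k l * a k) :
    ∃ M : ℝ, ∀ n : ℕ, ‖scaledRatio l a n - 4 * n‖ ≤ M := by
  have hP := ne_zero_and_le_re_scaledRatio hl h0 h1 hrec
  refine ⟨max ‖scaledRatio l a 0‖ (3 * (‖l‖ + 26)), fun n => ?_⟩
  induction n with
  | zero => simp
  | succ n ih =>
    set M := max ‖scaledRatio l a 0‖ (3 * (‖l‖ + 26))
    have hM : 3 * (‖l‖ + 26) ≤ M := le_max_right _ _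
    have hn0 : (0 : ℝ) ≤ n := n.cast_nonneg
    rw [scaledRatio_succ hl hrec (hP (n + 1)).1]
    have hv := (hP n).2.trans (Complex.re_le_norm _)
    set v := scaledRatio l a n
    have hvpos : 0 < ‖v‖ := by linarith
    have hv0 : v ≠ 0 := norm_pos_iff.mp hvpos
    have hd : ‖((8 : ℝ) : ℂ) / (l + 2 * n + 4)‖ ≤ 2 := by
      have h4 : 4 ≤ ‖l + 2 * n + 4‖ := by
        refine le_trans ?_ (Complex.re_le_norm _)
        simp
        linarith
      rw [norm_div, Complex.norm_of_nonneg (by norm_num), div_le_iff₀ (by linarith)]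
      linarith
    have hq : ‖((36 * n + 28 : ℝ) : ℂ) / v‖ ≤ 12 := by
      rw [norm_div, Complex.norm_of_nonneg (by positivity), div_le_iff₀ hvpos]
      linarith
    have hk : ‖((2 * n : ℝ) : ℂ) / v‖ ≤ 2 / 3 := by
      rw [norm_div, Complex.norm_of_nonneg (by positivity), div_le_iff₀ hvpos]
      linarith
    have heq : l + 6 * n + 16 - ((8 : ℝ) : ℂ) / (l + 2 * n + 4)
          - ((8 * (n : ℝ) ^ 2 + 36 * n + 28 : ℝ) : ℂ) / v - 4 * ((n + 1 : ℕ) : ℂ)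
        = ((2 * n : ℝ) : ℂ) / v * (v - 4 * n)
          + (l + 12 - ((8 : ℝ) : ℂ) / (l + 2 * n + 4) - ((36 * n + 28 : ℝ) : ℂ) / v) := by
      generalize ((8 : ℝ) : ℂ) / (l + 2 * n + 4) = d
      push_cast
      field_simp
      ring
    rw [heq]
    have hprod : ‖((2 * n : ℝ) : ℂ) / v * (v - 4 * n)‖ ≤ 2 / 3 * M := by
      rw [norm_mul]
      gcongr
    have hrest : ‖l + 12 - ((8 : ℝ) : ℂ) / (l + 2 * n + 4) - ((36 * n + 28 : ℝ) : ℂ) / v‖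
        ≤ ‖l‖ + 12 + 2 + 12 := by
      refine (norm_sub_le _ _).trans (add_le_add ((norm_sub_le _ _).trans (add_le_add ?_ hd)) hq)
      refine (norm_add_le _ _).trans ?_
      simp
    refine (norm_add_le _ _).trans ?_
    linarith

lemma tendsto_scaledRatio_div {l : ℂ} (hl : 0 ≤ l.re) {a : ℕ → ℂ}
    (h0 : a 0 = 1) (h1 : a 1 = (l ^ 2 + 12 * l + 12) / 28)
    (hrec : ∀ k : ℕ, a (k + 2) = An k l * a (k + 1) + Bn k l * a k) :
    Tendsto (fun n : ℕ => scaledRatio l a n / n) atTop (nhds 4) := by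
  obtain ⟨M, hM⟩ := exists_norm_scaledRatio_sub_le hl h0 h1 hrec
  have hz : Tendsto (fun n : ℕ => (scaledRatio l a n - 4 * n) / n) atTop (nhds 0) := by
    refine squeeze_zero_norm (fun n => ?_) (tendsto_const_div_atTop_nhds_zero_nat M)
    rw [norm_div, Complex.norm_natCast]
    gcongr
    exact hM n
  have h4 := hz.add_const 4
  rw [zero_add] at h4
  refine h4.congr' ?_
  filter_upwards [eventually_ne_atTop 0] with n hn
  have : (n : ℂ) ≠ 0 := by exact_mod_cast hn
  field_simp
  ring

lemma tendsto_ratio_one {l : ℂ} (hl : 0 ≤ l.re) {a : ℕ → ℂ}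
    (h0 : a 0 = 1) (h1 : a 1 = (l ^ 2 + 12 * l + 12) / 28)
    (hrec : ∀ k : ℕ, a (k + 2) = An k l * a (k + 1) + Bn k l * a k) :
    Tendsto (fun n => a (n + 1) / a n) atTop (nhds 1) := by
  have hP := ne_zero_and_le_re_scaledRatio hl h0 h1 hrec
  have hv := tendsto_scaledRatio_div hl h0 h1 hrec
  have hc (c : ℂ) : Tendsto (fun n : ℕ => c / (n : ℂ)) atTop (nhds 0) :=
    tendsto_const_div_atTop_nhds_zero_nat c
  have hnum : Tendsto (fun n : ℕ => (l + 2) / (n : ℂ) + 2) atTop (nhds 2) := by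
    simpa using (hc (l + 2)).add_const 2
  have hden : Tendsto (fun n : ℕ => 8 + 36 / (n : ℂ) + 28 / (n : ℂ) * (1 / (n : ℂ))) atTop
      (nhds 8) := by
    simpa using ((hc 36).const_add 8).add ((hc 28).mul (hc 1))
  have h := (hv.mul hnum).div hden (by norm_num)
  norm_num at h
  refine h.congr' ?_
  filter_upwards [eventually_ne_atTop 0] with n hn
  have hn' : (n : ℂ) ≠ 0 := by exact_mod_cast hn
  have ha := (hP n).1
  have e2 := add_two_mul_nat_add_ne_zero hl n (c := 2) (by norm_num)
  have q1 := quadratic_nat_ne_zero (b := 36) (c := 28) (by norm_num) (by norm_num) n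
  push_cast at e2 q1
  have hx : (l + 2) / (n : ℂ) + 2 = (l + 2 * n + 2) / n := by
    field_simp
    ring
  have hy : 8 + 36 / (n : ℂ) + 28 / (n : ℂ) * (n : ℂ)⁻¹
      = (8 * (n : ℂ) ^ 2 + 36 * n + 28) / (n : ℂ) ^ 2 := by
    field_simp
  simp only [Pi.div_apply, hx, hy, scaledRatio]
  generalize 8 * (n : ℂ) ^ 2 + 36 * n + 28 = F at q1
  generalize l + 2 * (n : ℂ) + 2 = L at e2
  field_simp

/-- The coefficient ratios of the analytic-at-zero Heun solution converge to `1`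
when `Re λ ≥ 0`; in particular the power series has radius of convergence
exactly `1`. -/
theorem ratio_tendsto_one_and_radius_one (l : ℂ) (hl : 0 ≤ l.re) (a : ℕ → ℂ)
    (h0 : a 0 = 1) (h1 : a 1 = (l ^ 2 + 12 * l + 12) / 28)
    (hrec : ∀ k : ℕ, a (k + 2) = An k l * a (k + 1) + Bn k l * a k) :
    (∀ n : ℕ, 1 ≤ n → a n ≠ 0) ∧
    Tendsto (fun n => a (n + 1) / a n) atTop (nhds 1) ∧
    (∀ z : ℂ, ‖z‖ < 1 → Summable fun n => a n * z ^ n) ∧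
    (∀ z : ℂ, 1 < ‖z‖ → ¬ Summable fun n => a n * z ^ n) := by
  have ha n := (ne_zero_and_le_re_scaledRatio hl h0 h1 hrec n).1
  have hr := tendsto_ratio_one hl h0 h1 hrec
  have hratio (z : ℂ) (hz : z ≠ 0) :
      Tendsto (fun n => ‖a (n + 1) * z ^ (n + 1)‖ / ‖a n * z ^ n‖) atTop (nhds ‖z‖) := by
    have h := (hr.mul_const z).norm
    rw [one_mul] at h
    refine h.congr fun n => ?_
    rw [← norm_div]
    congr 1
    have := ha n
    field_simp
    ring
  refine ⟨fun n _ => ha n, hr, fun z hz => ?_, fun z hz => ?_⟩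
  · rcases eq_or_ne z 0 with rfl | hz0
    · exact summable_of_ne_finset_zero (s := {0}) fun n hn => by simp_all
    · exact summable_of_ratio_test_tendsto_lt_one hz
        (Eventually.of_forall fun n => mul_ne_zero (ha n) (pow_ne_zero n hz0)) (hratio z hz0)
  · have hz0 : z ≠ 0 := norm_pos_iff.mp (by linarith)
    exact not_summable_of_ratio_test_tendsto_gt_one hz (hratio z hz0)
end
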